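/- arXiv:1706.05074 — 3 statements merged into one kernel-verified Lean document; each statement's English description precedes it below -/
import Mathlib

section
/- The symmetric rank and the symmetric border rank of sM^{S,0}_3 both equal 8: the cubic polynomial A ↦ trace(A^3) on the 5-dimensional space of traceless symmetric 3×3 complex matrices can be written as a sum of 8 cubes of linear forms, and it does not lie in the closure of the set of cubics of symmetric rank at most 7. -/
open Filter Matrix

/-- Symmetric (Waring) rank of a cubic polynomial: the smallest `r` such that
`P = ℓ₁³ + ⋯ + ℓᵣ³` for linear forms `ℓᵢ`. -/
noncomputable def symRank {W : Type*} [AddCommGroup W] [Module ℂ W]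
    (P : W → ℂ) : ℕ :=
  sInf {r : ℕ | ∃ ℓ : Fin r → (W →ₗ[ℂ] ℂ), ∀ a, P a = ∑ i, (ℓ i a) ^ 3}

/-- Symmetric border rank of a cubic polynomial: the smallest `r` such that `P` is a
limit of cubics of symmetric rank at most `r` (pointwise convergence, which on the
finite-dimensional space of cubics agrees with the usual topology). -/
noncomputable def symBorderRank {W : Type*} [AddCommGroup W] [Module ℂ W]
    (P : W → ℂ) : ℕ :=
  sInf {r : ℕ | ∃ ℓ : ℕ → Fin r → (W →ₗ[ℂ] ℂ),
    ∀ a, Tendsto (fun m => ∑ i, (ℓ m i a) ^ 3) atTop (nhds (P a))}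

/-- The space of traceless symmetric n×n complex matrices. -/
noncomputable def symMat0 (n : ℕ) : Submodule ℂ (Matrix (Fin n) (Fin n) ℂ) where
  carrier := {A | Aᵀ = A ∧ A.trace = 0}
  add_mem' := by
    intro a b ha hb
    simp only [Set.mem_setOf_eq] at *
    rw [Matrix.transpose_add, Matrix.trace_add, ha.1, hb.1, ha.2, hb.2]
    simp
  zero_mem' := by simp
  smul_mem' := by
    intro c A hA
    simp only [Set.mem_setOf_eq] at *
    rw [Matrix.transpose_smul, Matrix.trace_smul, hA.1, hA.2]
    simp

/-- `sM^{S,0}_n`: the restriction of `sM_n` to traceless symmetric matrices. -/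
noncomputable def sMS0 (n : ℕ) : symMat0 n → ℂ :=
  fun A => ((A : Matrix (Fin n) (Fin n) ℂ) ^ 3).trace

/-- Weight basis of the space of traceless symmetric matrices. -/
noncomputable def bas : Fin 5 → Matrix (Fin 3) (Fin 3) ℂ :=
  ![!![1, Complex.I, 0; Complex.I, -1, 0; 0, 0, 0],
    !![0, 0, 1; 0, 0, Complex.I; 1, Complex.I, 0],
    !![1, 0, 0; 0, 1, 0; 0, 0, -2],
    !![0, 0, 1; 0, 0, -Complex.I; 1, -Complex.I, 0],
    !![1, -Complex.I, 0; -Complex.I, -1, 0; 0, 0, 0]]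

theorem bas_mem (i : Fin 5) : bas i ∈ symMat0 3 := by
  refine ⟨?_, ?_⟩
  · ext a b
    fin_cases i <;> fin_cases a <;> fin_cases b <;> simp [bas]
  · fin_cases i <;> simp [bas, Matrix.trace_fin_three]
    norm_num

/-- Table of the polarised trilinear form in the weight basis. -/
noncomputable def tab (i j k : Fin 5) : ℂ :=
  if i.val + j.val + k.val ≠ 6 then 0
  else if i = 0 ∨ j = 0 ∨ k = 0 ∨ i = 4 ∨ j = 4 ∨ k = 4 then 4
  else if i = 2 ∧ j = 2 then -6 else -2

theorem trace_bas (i j k : Fin 5) : (bas i * bas j * bas k).trace = tab i j k := by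
  fin_cases i <;> fin_cases j <;> fin_cases k <;>
    simp [bas, tab, Matrix.trace_fin_three, Fin.ext_iff] <;> ring_nf <;>
    simp [Complex.I_sq] <;> norm_num

theorem tab_inj (u : Fin 5 → Fin 5 → Fin 5 → ℂ) (ha : ∀ a j k, u a j k + u a k j = 0)
    (ht : ∀ k, ∑ a, u a a k = 0)
    (h : ∀ m i j k, ∑ a, (tab a m i * u a j k + tab a m j * u a k i + tab a m k * u a i j) = 0) :
    u = 0 := by
  have d : ∀ a j, u a j j = 0 := fun a j => by linear_combination (1/2) * ha a j j
  have s10 : ∀ a, u a 1 0 = - u a 0 1 := fun a => by linear_combination ha a 1 0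
  have s20 : ∀ a, u a 2 0 = - u a 0 2 := fun a => by linear_combination ha a 2 0
  have s30 : ∀ a, u a 3 0 = - u a 0 3 := fun a => by linear_combination ha a 3 0
  have s40 : ∀ a, u a 4 0 = - u a 0 4 := fun a => by linear_combination ha a 4 0
  have s21 : ∀ a, u a 2 1 = - u a 1 2 := fun a => by linear_combination ha a 2 1
  have s31 : ∀ a, u a 3 1 = - u a 1 3 := fun a => by linear_combination ha a 3 1
  have s41 : ∀ a, u a 4 1 = - u a 1 4 := fun a => by linear_combination ha a 4 1
  have s32 : ∀ a, u a 3 2 = - u a 2 3 := fun a => by linear_combination ha a 3 2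
  have s42 : ∀ a, u a 4 2 = - u a 2 4 := fun a => by linear_combination ha a 4 2
  have s43 : ∀ a, u a 4 3 = - u a 3 4 := fun a => by linear_combination ha a 4 3
  simp only [tab, Fin.sum_univ_five] at h ht
  have e0012 := h 0 0 1 2
  have e0013 := h 0 0 1 3
  have e0014 := h 0 0 1 4
  have e0023 := h 0 0 2 3
  have e0024 := h 0 0 2 4
  have e0034 := h 0 0 3 4
  have e0123 := h 0 1 2 3
  have e0124 := h 0 1 2 4
  have e0134 := h 0 1 3 4
  have e0234 := h 0 2 3 4
  have e1012 := h 1 0 1 2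
  have e1013 := h 1 0 1 3
  have e1014 := h 1 0 1 4
  have e1023 := h 1 0 2 3
  have e1024 := h 1 0 2 4
  have e1034 := h 1 0 3 4
  have e1123 := h 1 1 2 3
  have e1124 := h 1 1 2 4
  have e1134 := h 1 1 3 4
  have e1234 := h 1 2 3 4
  have e2012 := h 2 0 1 2
  have e2014 := h 2 0 1 4
  have e2023 := h 2 0 2 3
  have e2024 := h 2 0 2 4
  have e2034 := h 2 0 3 4
  have e2123 := h 2 1 2 3
  have e2124 := h 2 1 2 4
  have e2134 := h 2 1 3 4
  have e2234 := h 2 2 3 4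
  have e3012 := h 3 0 1 2
  have e3013 := h 3 0 1 3
  have e3014 := h 3 0 1 4
  have e3023 := h 3 0 2 3
  have e3024 := h 3 0 2 4
  have e3034 := h 3 0 3 4
  have e3123 := h 3 1 2 3
  have e3124 := h 3 1 2 4
  have e3134 := h 3 1 3 4
  have e3234 := h 3 2 3 4
  have e4014 := h 4 0 1 4
  have e4024 := h 4 0 2 4
  have e4034 := h 4 0 3 4
  have e4124 := h 4 1 2 4
  have e4134 := h 4 1 3 4
  have e4234 := h 4 2 3 4
  have t0 := ht 0
  have t1 := ht 1
  have t2 := ht 2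
  have t3 := ht 3
  have t4 := ht 4
  clear h ht ha
  simp [d, s10, s20, s30, s40, s21, s31, s41, s32, s42, s43] at e0012 e0013 e0014 e0023 e0024 e0034 e0123 e0124 e0134 e0234 e1012 e1013 e1014 e1023 e1024 e1034 e1123 e1124 e1134 e1234 e2012 e2014 e2023 e2024 e2034 e2123 e2124 e2134 e2234 e3012 e3013 e3014 e3023 e3024 e3034 e3123 e3124 e3134 e3234 e4014 e4024 e4034 e4124 e4134 e4234 t0 t1 t2 t3 t4
  have u401 : u 4 0 1 = 0 := by linear_combination (1) * e0012
  have u301 : u 3 0 1 = 0 := by linear_combination (1) * e0013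
  have u402 : u 4 0 2 = 0 := by linear_combination (-1/2) * e0013 + (-1/4) * e1012
  have u201 : u 2 0 1 = 0 := by linear_combination (1) * e0014
  have u302 : u 3 0 2 = 0 := by linear_combination (-1/2) * e0014 + (1/4) * e0023 + (-1/4) * e1013
  have u403 : u 4 0 3 = 0 := by linear_combination (-1/2) * e0014 + (-1/4) * e1013
  have u412 : u 4 1 2 = 0 := by linear_combination (7/4) * e0014 + (-1/8) * e0023 + (1/8) * e1013 + (1/4) * e2012
  have u101 : u 1 0 1 = 0 := by linear_combination (-1/8) * e0024 + (3/16) * e1014 + (-1/8) * e1023 + (-1/4) * t0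
  have u202 : u 2 0 2 = 0 := by linear_combination (1/8) * e0024 + (-1/16) * e1014 + (-1/8) * e1023 + (-1/4) * t0
  have u303 : u 3 0 3 = 0 := by linear_combination (1/8) * e0024 + (-1/16) * e1014 + (3/8) * e1023 + (-1/4) * t0
  have u312 : u 3 1 2 = 0 := by linear_combination (-1/8) * e0024 + (1/8) * e1014 + (1/4) * e3012
  have u404 : u 4 0 4 = 0 := by linear_combination (-1/8) * e0024 + (-1/16) * e1014 + (-1/8) * e1023 + (-1/4) * t0
  have u413 : u 4 1 3 = 0 := by linear_combination (-1/8) * e0024 + (-1/4) * e0123 + (1/8) * e1014 + (1/4) * e3012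
  have u001 : u 0 0 1 = 0 := by linear_combination (1/16) * e0034 + (5/56) * e0124 + (-3/112) * e1024 + (3/56) * e1123 + (17/112) * e2014 + (-3/56) * e2023 + (1/28) * e3013 + (1/4) * t1
  have u102 : u 1 0 2 = 0 := by linear_combination (1/8) * e0034 + (1/28) * e0124 + (3/14) * e1024 + (1/14) * e1123 + (1/28) * e2014 + (-1/14) * e2023 + (-1/28) * e3013
  have u203 : u 2 0 3 = 0 := by linear_combination (-1/14) * e0124 + (1/14) * e1024 + (-1/7) * e1123 + (-1/14) * e2014 + (1/7) * e2023 + (1/14) * e3013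
  have u212 : u 2 1 2 = 0 := by linear_combination (1/16) * e0034 + (11/56) * e0124 + (-1/112) * e1024 + (1/56) * e1123 + (15/112) * e2014 + (-1/56) * e2023 + (-1/14) * e3013 + (-1/4) * t1
  have u304 : u 3 0 4 = 0 := by linear_combination (-1/4) * e0034 + (-1/14) * e0124 + (1/14) * e1024 + (-1/7) * e1123 + (-1/14) * e2014 + (1/7) * e2023 + (1/14) * e3013
  have u313 : u 3 1 3 = 0 := by linear_combination (-1/16) * e0034 + (-3/56) * e0124 + (-1/112) * e1024 + (1/56) * e1123 + (-13/112) * e2014 + (-1/56) * e2023 + (5/28) * e3013 + (-1/4) * t1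
  have u414 : u 4 1 4 = 0 := by linear_combination (1/16) * e0034 + (-3/56) * e0124 + (-1/112) * e1024 + (1/56) * e1123 + (15/112) * e2014 + (-1/56) * e2023 + (-1/14) * e3013 + (-1/4) * t1
  have u423 : u 4 2 3 = 0 := by linear_combination (1/16) * e0034 + (1/8) * e0124 + (1/4) * e1123 + (1/8) * e2014 + (-1/8) * e3013
  have u002 : u 0 0 2 = 0 := by linear_combination (-9/56) * e0134 + (-13/224) * e1034 + (-1/112) * e1124 + (1/14) * e2024 + (3/28) * e2123 + (-5/32) * e3014 + (13/112) * e3023 + (1/4) * t2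
  have u103 : u 1 0 3 = 0 := by linear_combination (-3/28) * e0134 + (13/56) * e1034 + (1/28) * e1124 + (-1/28) * e2024 + (1/14) * e2123 + (-1/8) * e3014 + (1/28) * e3023
  have u112 : u 1 1 2 = 0 := by linear_combination (3/14) * e0134 + (1/224) * e1034 + (13/112) * e1124 + (-3/56) * e2024 + (-1/7) * e2123 + (5/32) * e3014 + (-1/112) * e3023 + (1/4) * t2
  have u204 : u 2 0 4 = 0 := by linear_combination (3/14) * e0134 + (1/28) * e1034 + (-1/14) * e1124 + (1/14) * e2024 + (-1/7) * e2123 + (1/4) * e3014 + (-1/14) * e3023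
  have u213 : u 2 1 3 = 0 := by linear_combination (1/7) * e0134 + (-1/56) * e1034 + (1/28) * e1124 + (-1/28) * e2024 + (1/14) * e2123 + (1/8) * e3014 + (1/28) * e3023
  have u314 : u 3 1 4 = 0 := by linear_combination (-3/28) * e0134 + (-1/56) * e1034 + (1/28) * e1124 + (-1/28) * e2024 + (1/14) * e2123 + (1/8) * e3014 + (1/28) * e3023
  have u323 : u 3 2 3 = 0 := by linear_combination (3/14) * e0134 + (-13/224) * e1034 + (-1/112) * e1124 + (-3/56) * e2024 + (-1/7) * e2123 + (7/32) * e3014 + (13/112) * e3023 + (-1/4) * t2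
  have u424 : u 4 2 4 = 0 := by linear_combination (-9/56) * e0134 + (1/224) * e1034 + (13/112) * e1124 + (1/14) * e2024 + (3/28) * e2123 + (-7/32) * e3014 + (-1/112) * e3023 + (-1/4) * t2
  have u003 : u 0 0 3 = 0 := by linear_combination (-3/56) * e0234 + (-1/14) * e1134 + (3/16) * e2034 + (-1/56) * e2124 + (-1/16) * e3024 + (1/56) * e3123 + (1/16) * e4014 + (1/4) * t3
  have u012 : u 0 1 2 = 0 := by linear_combination (1/8) * e0234 + (-1/8) * e1134 + (1/8) * e3024 + (1/4) * e3123 + (1/16) * e4014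
  have u104 : u 1 0 4 = 0 := by linear_combination (-1/14) * e0234 + (1/14) * e1134 + (1/7) * e2124 + (-1/7) * e3123 + (-1/4) * e4014
  have u113 : u 1 1 3 = 0 := by linear_combination (-3/56) * e0234 + (5/28) * e1134 + (-1/16) * e2034 + (-1/56) * e2124 + (-1/16) * e3024 + (1/56) * e3123 + (-1/16) * e4014 + (1/4) * t3
  have u214 : u 2 1 4 = 0 := by linear_combination (-1/14) * e0234 + (1/14) * e1134 + (1/7) * e2124 + (-1/7) * e3123
  have u223 : u 2 2 3 = 0 := by linear_combination (11/56) * e0234 + (-1/14) * e1134 + (-1/16) * e2034 + (-1/56) * e2124 + (3/16) * e3024 + (1/56) * e3123 + (1/16) * e4014 + (1/4) * t3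
  have u324 : u 3 2 4 = 0 := by linear_combination (1/28) * e0234 + (-1/28) * e1134 + (-1/14) * e2124 + (1/4) * e3024 + (1/14) * e3123 + (1/8) * e4014
  have u434 : u 4 3 4 = 0 := by linear_combination (5/56) * e0234 + (1/28) * e1134 + (1/16) * e2034 + (-3/56) * e2124 + (1/16) * e3024 + (3/56) * e3123 + (1/16) * e4014 + (-1/4) * t3
  have u004 : u 0 0 4 = 0 := by linear_combination (-1/16) * e3034 + (-1/8) * e3124 + (-1/8) * e4024 + (1/4) * t4
  have u013 : u 0 1 3 = 0 := by linear_combination (1/4) * e2134 + (1/8) * e3034 + (-1/4) * e3124 + (-1/8) * e4024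
  have u114 : u 1 1 4 = 0 := by linear_combination (-1/16) * e3034 + (3/8) * e3124 + (1/8) * e4024 + (1/4) * t4
  have u123 : u 1 2 3 = 0 := by linear_combination (1/4) * e1234 + (1/8) * e3034 + (-1/8) * e4024
  have u224 : u 2 2 4 = 0 := by linear_combination (-1/16) * e3034 + (-1/8) * e3124 + (1/8) * e4024 + (1/4) * t4
  have u334 : u 3 3 4 = 0 := by linear_combination (3/16) * e3034 + (-1/8) * e3124 + (-1/8) * e4024 + (1/4) * t4
  have u014 : u 0 1 4 = 0 := by linear_combination (-1/4) * e3134 + (-1/2) * e4034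
  have u023 : u 0 2 3 = 0 := by linear_combination (1/4) * e2234 + (1/8) * e3134 + (7/4) * e4034 + (-1/8) * e4124
  have u124 : u 1 2 4 = 0 := by linear_combination (-1/4) * e3134 + (-1/2) * e4034 + (1/4) * e4124
  have u234 : u 2 3 4 = 0 := by linear_combination (1) * e4034
  have u024 : u 0 2 4 = 0 := by linear_combination (-1/4) * e3234 + (-1/2) * e4134
  have u134 : u 1 3 4 = 0 := by linear_combination (1) * e4134
  have u034 : u 0 3 4 = 0 := by linear_combination (1) * e4234
  funext a j k
  fin_cases a <;> fin_cases j <;> fin_cases k <;> simp [d, s10, s20, s30, s40, s21, s31, s41, s32, s42, s43, u001, u002, u003, u004, u012, u013, u014, u023, u024, u034, u101, u102, u103, u104, u112, u113, u114, u123, u124, u134, u201, u202, u203, u204, u212, u213, u214, u223, u224, u234, u301, u302, u303, u304, u312, u313, u314, u323, u324, u334, u401, u402, u403, u404, u412, u413, u414, u423, u424, u434]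

theorem sMS0_polar (A B C : symMat0 3) :
    sMS0 3 (A + B + C) - sMS0 3 (A + B) - sMS0 3 (A + C) - sMS0 3 (B + C)
      + sMS0 3 A + sMS0 3 B + sMS0 3 C
      = 6 * ((A : Matrix (Fin 3) (Fin 3) ℂ) * B * C).trace := by
  obtain ⟨A, hA⟩ := A
  obtain ⟨B, hB⟩ := B
  obtain ⟨C, hC⟩ := C
  have key : ∀ X Y Z : Matrix (Fin 3) (Fin 3) ℂ, (X + Y + Z) ^ 3 - (X + Y) ^ 3 - (X + Z) ^ 3
      - (Y + Z) ^ 3 + X ^ 3 + Y ^ 3 + Z ^ 3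
      = X * Y * Z + X * Z * Y + Y * X * Z + Y * Z * X + Z * X * Y + Z * Y * X := by
    intro X Y Z
    noncomm_ring
  have h := congrArg Matrix.trace (key A B C)
  simp only [Matrix.trace_add, Matrix.trace_sub] at h
  have e1 : (B * C * A).trace = (A * B * C).trace := by
    rw [Matrix.trace_mul_comm, ← Matrix.mul_assoc]
  have e2 : (C * A * B).trace = (A * B * C).trace := by
    rw [Matrix.mul_assoc, Matrix.trace_mul_comm]
  have e3 : (C * B * A).trace = (A * B * C).trace := by
    rw [← Matrix.trace_transpose (A * B * C)]
    simp only [Matrix.transpose_mul]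
    rw [hA.1, hB.1, hC.1, Matrix.mul_assoc]
  have e4 : (B * A * C).trace = (A * B * C).trace := by
    rw [← e3, Matrix.trace_mul_comm, ← Matrix.mul_assoc]
  have e5 : (A * C * B).trace = (A * B * C).trace := by
    rw [← e3, Matrix.mul_assoc, Matrix.trace_mul_comm]
  rw [e1, e2, e3, e4, e5] at h
  simp only [sMS0, Submodule.coe_add]
  rw [h]
  ring

/-- Constraints cutting out the traceless tensors in `V* ⊗ Λ² V`. -/
def cons : Submodule ℂ (Fin 5 → Fin 5 → Fin 5 → ℂ) where
  carrier := {u | (∀ a j k, u a j k + u a k j = 0) ∧ ∀ k, ∑ a, u a a k = 0}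
  add_mem' := by
    rintro u v ⟨h1, h2⟩ ⟨h3, h4⟩
    refine ⟨fun a j k => ?_, fun k => ?_⟩
    · simp only [Pi.add_apply]
      linear_combination h1 a j k + h3 a j k
    · simp only [Pi.add_apply, Finset.sum_add_distrib, h2, h4, add_zero]
  zero_mem' := by simp
  smul_mem' := by
    rintro c u ⟨h1, h2⟩
    refine ⟨fun a j k => ?_, fun k => ?_⟩
    · simp only [Pi.smul_apply, smul_eq_mul]
      linear_combination c * h1 a j k
    · simp only [Pi.smul_apply, smul_eq_mul, ← Finset.mul_sum, h2, mul_zero]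

/-- The Koszul flattening of a trilinear form. -/
noncomputable def koszul : (Fin 5 → Fin 5 → Fin 5 → ℂ) →ₗ[ℂ] cons →ₗ[ℂ]
    (Fin 5 → Fin 5 → Fin 5 → Fin 5 → ℂ) :=
  LinearMap.mk₂ ℂ (fun T u m i j k =>
      ∑ a, (T a m i * u.1 a j k + T a m j * u.1 a k i + T a m k * u.1 a i j))
    (by
      intro T T' u
      funext m i j k
      simp only [Pi.add_apply, ← Finset.sum_add_distrib]
      exact Finset.sum_congr rfl fun a _ => by ring)
    (by
      intro c T u
      funext m i j k
      simp only [Pi.smul_apply, smul_eq_mul, Finset.mul_sum]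
      exact Finset.sum_congr rfl fun a _ => by ring)
    (by
      intro T u v
      funext m i j k
      simp only [Pi.add_apply, Submodule.coe_add, ← Finset.sum_add_distrib]
      exact Finset.sum_congr rfl fun a _ => by ring)
    (by
      intro c T u
      funext m i j k
      simp only [Pi.smul_apply, SetLike.val_smul, smul_eq_mul, Finset.mul_sum]
      exact Finset.sum_congr rfl fun a _ => by ring)

theorem koszul_apply (T : Fin 5 → Fin 5 → Fin 5 → ℂ) (u : cons) (m i j k : Fin 5) :
    koszul T u m i j k =
      ∑ a, (T a m i * u.1 a j k + T a m j * u.1 a k i + T a m k * u.1 a i j) := rfl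

theorem koszul_tab_injective : Function.Injective (koszul tab) := by
  rw [injective_iff_map_eq_zero]
  intro u hu
  apply Subtype.ext
  exact tab_inj u.1 u.2.1 u.2.2 fun m i j k => by
    rw [← koszul_apply, hu]; rfl

/-- The wedge of a vector with a skew form vanishes as soon as the six components through an
index with nonzero coefficient vanish. -/
theorem wedge_zero (l : Fin 5 → ℂ) (v : Fin 5 → Fin 5 → ℂ) (hv : ∀ j k, v j k + v k j = 0)
    (i : Fin 5) (hi : l i = 0 → l = 0)
    (h : ∀ p q : Fin 4, p < q → l i * v (i.succAbove p) (i.succAbove q)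
      + l (i.succAbove p) * v (i.succAbove q) i + l (i.succAbove q) * v i (i.succAbove p) = 0)
    (a b c : Fin 5) : l a * v b c + l b * v c a + l c * v a b = 0 := by
  by_cases h0 : l i = 0
  · simp [hi h0]
  have E : ∀ j k, l i * v j k + l j * v k i + l k * v i j = 0 := by
    intro j k
    have hd : ∀ j, v j j = 0 := fun j => by linear_combination (1/2) * hv j j
    by_cases hj : j = i
    · subst hj
      rw [hd]; linear_combination l j * hv j k
    by_cases hk : k = i
    · subst hk
      rw [hd]; linear_combination l k * hv j k
    obtain ⟨p, rfl⟩ := Fin.exists_succAbove_eq hj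
    obtain ⟨q, rfl⟩ := Fin.exists_succAbove_eq hk
    rcases lt_trichotomy p q with hpq | hpq | hpq
    · exact h p q hpq
    · subst hpq
      rw [hd]; linear_combination l (i.succAbove p) * hv (i.succAbove p) i
    · have := h q p hpq
      linear_combination -this + l i * hv (i.succAbove q) (i.succAbove p)
        + l (i.succAbove p) * hv i (i.succAbove q) + l (i.succAbove q) * hv i (i.succAbove p)
  apply mul_left_cancel₀ h0
  linear_combination l a * E b c + l b * E c a + l c * E a b - l a * l b * hv i c
    - l b * l c * hv i a - l a * l c * hv i b

theorem exists_ker {r : ℕ} (hr : r ≤ 7) (l : Fin r → Fin 5 → ℂ) :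
    ∃ u : cons, u ≠ 0 ∧ koszul (fun i j k => ∑ s, l s i * l s j * l s k) u = 0 := by
  have hi : ∀ s, ∃ i, l s i = 0 → l s = 0 := by
    intro s
    by_cases h : l s = 0
    · exact ⟨0, fun _ => h⟩
    · obtain ⟨i, hi⟩ := Function.ne_iff.mp h
      exact ⟨i, fun h' => absurd h' hi⟩
  choose i hi using hi
  let f1 : (Fin 5 → Fin 5 → Fin 5 → ℂ) →ₗ[ℂ]
      (Fin 5 × {p : Fin 5 × Fin 5 // p.1 ≤ p.2} → ℂ) :=
    { toFun := fun u x => u x.1 x.2.1.1 x.2.1.2 + u x.1 x.2.1.2 x.2.1.1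
      map_add' := by intro u v; funext x; simp only [Pi.add_apply]; ring
      map_smul' := by
        intro c u; funext x; simp only [Pi.smul_apply, smul_eq_mul, RingHom.id_apply]; ring }
  let f2 : (Fin 5 → Fin 5 → Fin 5 → ℂ) →ₗ[ℂ] (Fin 5 → ℂ) :=
    { toFun := fun u k => ∑ a, u a a k
      map_add' := by intro u v; funext x; simp only [Pi.add_apply, Finset.sum_add_distrib]
      map_smul' := by
        intro c u; funext x
        simp only [Pi.smul_apply, smul_eq_mul, RingHom.id_apply, Finset.mul_sum] }
  let w : Fin r → (Fin 5 → Fin 5 → Fin 5 → ℂ) → Fin 5 → Fin 5 → ℂ :=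
    fun s u j k => ∑ a, l s a * u a j k
  have wadd : ∀ s u v j k, w s (u + v) j k = w s u j k + w s v j k := by
    intro s u v j k
    simp only [w, Pi.add_apply, mul_add, Finset.sum_add_distrib]
  have wsmul : ∀ s (c : ℂ) u j k, w s (c • u) j k = c * w s u j k := by
    intro s c u j k
    simp only [w, Pi.smul_apply, smul_eq_mul, Finset.mul_sum]
    exact Finset.sum_congr rfl fun a _ => by ring
  let f3 : (Fin 5 → Fin 5 → Fin 5 → ℂ) →ₗ[ℂ]
      (Fin r × {p : Fin 4 × Fin 4 // p.1 < p.2} → ℂ) :=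
    { toFun := fun u x =>
        l x.1 (i x.1) * w x.1 u ((i x.1).succAbove x.2.1.1) ((i x.1).succAbove x.2.1.2)
        + l x.1 ((i x.1).succAbove x.2.1.1) * w x.1 u ((i x.1).succAbove x.2.1.2) (i x.1)
        + l x.1 ((i x.1).succAbove x.2.1.2) * w x.1 u (i x.1) ((i x.1).succAbove x.2.1.1)
      map_add' := by intro u v; funext x; simp only [Pi.add_apply, wadd]; ring
      map_smul' := by
        intro c u; funext x
        simp only [Pi.smul_apply, smul_eq_mul, RingHom.id_apply, wsmul]; ring }
  have c1 : Fintype.card {p : Fin 5 × Fin 5 // p.1 ≤ p.2} = 15 := by decide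
  have c2 : Fintype.card {p : Fin 4 × Fin 4 // p.1 < p.2} = 6 := by decide
  have hker : LinearMap.ker (f1.prod (f2.prod f3)) ≠ ⊥ := by
    apply LinearMap.ker_ne_bot_of_finrank_lt
    simp only [Module.finrank_prod, Module.finrank_fintype_fun_eq_card, Fintype.card_prod, c1, c2,
      Fintype.card_fin, Module.finrank_pi_fintype, Finset.sum_const, Finset.card_univ,
      smul_eq_mul]
    omega
  obtain ⟨u, hu, hu0⟩ := Submodule.exists_mem_ne_zero_of_ne_bot hker
  have hu' := LinearMap.mem_ker.mp hu
  have h1 : f1 u = 0 := congrArg Prod.fst hu'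
  have h2 : f2 u = 0 := congrArg (fun z => z.2.1) hu'
  have h3 : f3 u = 0 := congrArg (fun z => z.2.2) hu'
  have ha : ∀ a j k, u a j k + u a k j = 0 := by
    intro a j k
    rcases le_total j k with h | h
    · exact congrFun h1 (a, ⟨(j, k), h⟩)
    · rw [add_comm]
      exact congrFun h1 (a, ⟨(k, j), h⟩)
  refine ⟨⟨u, ha, fun k => congrFun h2 k⟩, fun h => hu0 (congrArg Subtype.val h), ?_⟩
  funext m p q t
  rw [koszul_apply]
  have hw : ∀ s j k, w s u j k + w s u k j = 0 := by
    intro s j k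
    simp only [w, ← Finset.sum_add_distrib, ← mul_add, ha, mul_zero, Finset.sum_const_zero]
  have hz : ∀ s, l s m * (l s p * w s u q t + l s q * w s u t p + l s t * w s u p q) = 0 := by
    intro s
    rw [wedge_zero (l s) (w s u) (hw s) (i s) (hi s) (fun p q hpq => congrFun h3 (s, ⟨(p, q), hpq⟩)),
      mul_zero]
  have : ∀ a, ((∑ s, l s a * l s m * l s p) * u a q t + (∑ s, l s a * l s m * l s q) * u a t p
      + (∑ s, l s a * l s m * l s t) * u a p q) = ∑ s, (l s m * l s p * (l s a * u a q t)
        + l s m * l s q * (l s a * u a t p) + l s m * l s t * (l s a * u a p q)) := by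
    intro a
    simp only [Finset.sum_mul, ← Finset.sum_add_distrib]
    exact Finset.sum_congr rfl fun s _ => by ring
  simp only [this]
  rw [Finset.sum_comm]
  apply Finset.sum_eq_zero
  intro s _
  rw [← hz s]
  simp only [w, Finset.sum_add_distrib, ← Finset.mul_sum]
  ring

theorem border_lower {r : ℕ} (hr : r ≤ 7) (ℓ : ℕ → Fin r → (symMat0 3 →ₗ[ℂ] ℂ))
    (h : ∀ a, Tendsto (fun m => ∑ i, (ℓ m i a) ^ 3) atTop (nhds (sMS0 3 a))) : False := by
  let b : Fin 5 → symMat0 3 := fun i => ⟨bas i, bas_mem i⟩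
  let T : ℕ → Fin 5 → Fin 5 → Fin 5 → ℂ := fun m i j k =>
    ∑ s, ℓ m s (b i) * ℓ m s (b j) * ℓ m s (b k)
  have hT : Tendsto T atTop (nhds tab) := by
    rw [tendsto_pi_nhds]; intro i
    rw [tendsto_pi_nhds]; intro j
    rw [tendsto_pi_nhds]; intro k
    have h1 := ((((((h (b i + b j + b k)).sub (h (b i + b j))).sub (h (b i + b k))).sub
      (h (b j + b k))).add (h (b i))).add (h (b j))).add (h (b k))
    rw [sMS0_polar, trace_bas] at h1
    have h2 := h1.const_mul (1 / 6 : ℂ)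
    convert h2 using 1
    · funext m
      simp only [T, ← Finset.sum_add_distrib, ← Finset.sum_sub_distrib, Finset.mul_sum, map_add]
      exact Finset.sum_congr rfl fun s _ => by ring
    · congr 1
      ring
  let Φ : (Fin 5 → Fin 5 → Fin 5 → ℂ) →ₗ[ℂ] (cons →L[ℂ] (Fin 5 → Fin 5 → Fin 5 → Fin 5 → ℂ)) :=
    (LinearMap.toContinuousLinearMap (𝕜 := ℂ) (E := cons)
      (F' := Fin 5 → Fin 5 → Fin 5 → Fin 5 → ℂ)).toLinearMap ∘ₗ koszul
  have hΦ : Continuous Φ := LinearMap.continuous_of_finiteDimensional (𝕜 := ℂ)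
    (F' := cons →L[ℂ] (Fin 5 → Fin 5 → Fin 5 → Fin 5 → ℂ)) Φ
  have hopen := (ContinuousLinearMap.isOpen_injective (𝕜 := ℂ) (E := cons)
      (F := Fin 5 → Fin 5 → Fin 5 → Fin 5 → ℂ)).preimage hΦ
  have hev := hT.eventually (hopen.mem_nhds (x := tab) koszul_tab_injective)
  obtain ⟨m, hm⟩ := hev.exists
  obtain ⟨u, hu, hk⟩ := exists_ker hr (fun s i => ℓ m s (b i))
  have hm' : Function.Injective (koszul (T m)) := hm
  exact hu (hm' (hk.trans (map_zero _).symm))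

theorem rank_upper : ∃ ℓ : Fin 8 → (symMat0 3 →ₗ[ℂ] ℂ), ∀ a, sMS0 3 a = ∑ i, (ℓ i a) ^ 3 := by
  obtain ⟨s, hs⟩ := IsAlgClosed.exists_pow_nat_eq (-7 : ℂ) (n := 2) (by norm_num)
  obtain ⟨t, ht⟩ : ∃ t : ℂ, 2 * t ^ 2 - t + 1 = 0 :=
    ⟨(1 + s) / 4, by linear_combination hs / 8⟩
  obtain ⟨d, hd⟩ := IsAlgClosed.exists_pow_nat_eq (2 * t - 1) (n := 2) (by norm_num)
  obtain ⟨c, hc⟩ := IsAlgClosed.exists_pow_nat_eq (-t ^ 2 / 4) (n := 3) (by norm_num)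
  obtain ⟨g, hg⟩ := IsAlgClosed.exists_pow_nat_eq (t / 2) (n := 3) (by norm_num)
  let e : Fin 3 → Fin 3 → (symMat0 3 →ₗ[ℂ] ℂ) := fun i j =>
    Matrix.entryLinearMap ℂ ℂ i j ∘ₗ (symMat0 3).subtype
  have he : ∀ i j a, e i j a = a.1 i j := fun _ _ _ => rfl
  refine ⟨![c • (e 0 0 + d • e 0 1 + d • e 0 2 + (1 - 2 * t) • e 1 2),
    c • (e 0 0 + d • e 0 1 - d • e 0 2 - (1 - 2 * t) • e 1 2),
    c • (e 0 0 - d • e 0 1 + d • e 0 2 - (1 - 2 * t) • e 1 2),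
    c • (e 0 0 - d • e 0 1 - d • e 0 2 + (1 - 2 * t) • e 1 2),
    g • (e 2 2 + t • e 0 0 + d • e 0 1), g • (e 2 2 + t • e 0 0 - d • e 0 1),
    g • (e 1 1 + t • e 0 0 + d • e 0 2), g • (e 1 1 + t • e 0 0 - d • e 0 2)], ?_⟩
  rintro ⟨A, hA, htr⟩
  have h10 : A 1 0 = A 0 1 := congrFun (congrFun hA 0) 1
  have h20 : A 2 0 = A 0 2 := congrFun (congrFun hA 0) 2
  have h21 : A 2 1 = A 1 2 := congrFun (congrFun hA 1) 2
  rw [Matrix.trace_fin_three] at htr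
  have hz : A 2 2 = - A 0 0 - A 1 1 := by linear_combination htr
  simp only [sMS0, pow_succ, pow_zero, one_mul, Matrix.trace_fin_three, Matrix.mul_apply,
    Fin.sum_univ_three, h10, h20, h21, hz]
  simp [Fin.sum_univ_succ, he, hz]
  generalize A 0 0 = x
  generalize A 1 1 = y
  generalize A 0 1 = p
  generalize A 0 2 = q
  generalize A 1 2 = r
  trans c ^ 3 * (4 * x ^ 3 + 12 * x * (d ^ 2 * (p ^ 2 + q ^ 2) + (1 - 2 * t) ^ 2 * r ^ 2)
      + 24 * d ^ 2 * (1 - 2 * t) * p * q * r)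
    + g ^ 3 * (2 * (-x - y + t * x) ^ 3 + 6 * (-x - y + t * x) * (d ^ 2 * p ^ 2)
      + 2 * (y + t * x) ^ 3 + 6 * (y + t * x) * (d ^ 2 * q ^ 2))
  · rw [hc, hg, hd]
    grind
  · ring

theorem symRank_and_symBorderRank_sMS0_3 :
    symRank (sMS0 3) = 8 ∧ symBorderRank (sMS0 3) = 8 := by
  obtain ⟨ℓ, hℓ⟩ := rank_upper
  have h8 : (∃ ℓ : Fin 8 → (symMat0 3 →ₗ[ℂ] ℂ), ∀ a, sMS0 3 a = ∑ i, (ℓ i a) ^ 3) := ⟨ℓ, hℓ⟩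
  constructor
  · apply le_antisymm
    · exact Nat.sInf_le h8
    · refine le_csInf ⟨8, h8⟩ ?_
      rintro r ⟨m, hm⟩
      by_contra hr
      refine border_lower (r := r) (by omega) (fun _ => m) fun a => ?_
      rw [hm a]
      exact tendsto_const_nhds
  · have h8' : (∃ ℓ : ℕ → Fin 8 → (symMat0 3 →ₗ[ℂ] ℂ),
        ∀ a, Tendsto (fun m => ∑ i, (ℓ m i a) ^ 3) atTop (nhds (sMS0 3 a))) :=
      ⟨fun _ => ℓ, fun a => by rw [hℓ a]; exact tendsto_const_nhds⟩
    apply le_antisymm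
    · exact Nat.sInf_le h8'
    · refine le_csInf ⟨8, h8'⟩ ?_
      rintro r ⟨m, hm⟩
      by_contra hr
      exact border_lower (r := r) (by omega) m hm
end

section
/- For every n ≥ 3 and every symmetric n×n complex matrix A with zero diagonal, 2^{n+2}·trace(A^3) = Σ_{v ∈ P_n} (trace((v·vᵀ − I_n)·A))^3, where the sum ranges over the 2^{n-1} vectors in P_n. In particular, the symmetric rank of sM^Z_n is at most 2^{n-1}. -/
open Filter Matrix

/-- The space `Z_n` of symmetric n×n complex matrices with zero diagonal. -/
noncomputable def zeroDiagSym (n : ℕ) : Submodule ℂ (Matrix (Fin n) (Fin n) ℂ) where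
  carrier := {A | Aᵀ = A ∧ ∀ i, A i i = 0}
  add_mem' := by
    intro a b ha hb
    refine ⟨by rw [Matrix.transpose_add, ha.1, hb.1], fun i => ?_⟩
    simp [ha.2 i, hb.2 i]
  zero_mem' := by simp
  smul_mem' := by
    intro c A hA
    refine ⟨by rw [Matrix.transpose_smul, hA.1], fun i => ?_⟩
    simp [hA.2 i]

/-- `sM^Z_n`: the restriction of `sM_n` to symmetric matrices with zero diagonal. -/
noncomputable def sMZ (n : ℕ) : zeroDiagSym n → ℂ :=
  fun A => ((A : Matrix (Fin n) (Fin n) ℂ) ^ 3).trace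

/-- The ±1 vector associated to a sign pattern `ε`, with `+1` where `ε` is `true`. -/
noncomputable def pmVec {n : ℕ} (ε : Fin n → Bool) : Fin n → ℂ :=
  fun i => if ε i then 1 else -1

/-- Flip the sign at `i`. -/
def flipAt {n : ℕ} (i : Fin n) (ε : Fin n → Bool) : Fin n → Bool :=
  Function.update ε i (!ε i)

lemma flipAt_invol {n : ℕ} (i : Fin n) : Function.Involutive (flipAt i) := by
  intro ε
  simp [flipAt]

lemma pmVec_flip_same {n : ℕ} (i : Fin n) (ε : Fin n → Bool) :
    pmVec (flipAt i ε) i = - pmVec ε i := by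
  simp only [pmVec, flipAt, Function.update_self]
  cases ε i <;> simp

lemma pmVec_flip_ne {n : ℕ} (i j : Fin n) (h : i ≠ j) (ε : Fin n → Bool) :
    pmVec (flipAt i ε) j = pmVec ε j := by
  simp only [pmVec, flipAt, Function.update_of_ne h.symm]

lemma pmVec_sq {n : ℕ} (ε : Fin n → Bool) (i : Fin n) : pmVec ε i * pmVec ε i = 1 := by
  simp only [pmVec]
  cases ε i <;> simp

lemma sum_flip_zero {n : ℕ} (i : Fin n) (f : (Fin n → Bool) → ℂ)
    (h : ∀ ε, f (flipAt i ε) = - f ε) : ∑ ε, f ε = 0 := by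
  have h1 : ∑ ε, f (flipAt i ε) = ∑ ε, f ε :=
    Equiv.sum_comp (flipAt_invol i).toPerm f
  simp only [h, Finset.sum_neg_distrib] at h1
  linear_combination (-1/2 : ℂ) * h1

lemma sum_two {n : ℕ} (i j : Fin n) :
    ∑ ε : Fin n → Bool, pmVec ε i * pmVec ε j = 2 ^ n * (if i = j then 1 else 0) := by
  by_cases h : i = j
  · subst h
    simp [pmVec_sq]
  · rw [if_neg h, mul_zero]
    apply sum_flip_zero i
    intro ε
    rw [pmVec_flip_same, pmVec_flip_ne i j h]
    ring

lemma sum_four {n : ℕ} (i j k l : Fin n) (hkl : k ≠ l) :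
    ∑ ε : Fin n → Bool, pmVec ε i * pmVec ε j * pmVec ε k * pmVec ε l =
      2 ^ n * ((if i = k then 1 else 0) * (if j = l then 1 else 0)
        + (if i = l then 1 else 0) * (if j = k then 1 else 0)) := by
  by_cases h1 : i = k
  · subst h1
    rw [if_pos rfl, if_neg hkl, one_mul, zero_mul, add_zero, ← sum_two j l]
    refine Finset.sum_congr rfl fun ε _ => ?_
    linear_combination (pmVec ε j * pmVec ε l) * pmVec_sq ε i
  by_cases h2 : i = l
  · subst h2
    rw [if_pos rfl, if_neg h1, one_mul, zero_mul, zero_add, ← sum_two j k]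
    refine Finset.sum_congr rfl fun ε _ => ?_
    linear_combination (pmVec ε j * pmVec ε k) * pmVec_sq ε i
  rw [if_neg h1, if_neg h2, zero_mul, zero_mul, add_zero, mul_zero]
  by_cases h3 : i = j
  · subst h3
    apply sum_flip_zero k
    intro ε
    rw [pmVec_flip_same, pmVec_flip_ne k i (Ne.symm h1), pmVec_flip_ne k l hkl]
    ring
  · apply sum_flip_zero i
    intro ε
    rw [pmVec_flip_same, pmVec_flip_ne i j h3, pmVec_flip_ne i k h1, pmVec_flip_ne i l h2]
    ring

/-- Kronecker delta. -/
def dl {n : ℕ} (i j : Fin n) : ℂ := if i = j then 1 else 0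

lemma dl_self {n : ℕ} (i : Fin n) : dl i i = 1 := by simp [dl]
lemma dl_ne {n : ℕ} {i j : Fin n} (h : i ≠ j) : dl i j = 0 := by simp [dl, h]
lemma dl_mul_zero {n : ℕ} {i j k : Fin n} (h : j ≠ k) : dl i j * dl i k = 0 := by
  by_cases h1 : i = j
  · subst h1; rw [dl_ne h, mul_zero]
  · rw [dl_ne h1, zero_mul]

lemma sum_six {n : ℕ} (i j k l p q : Fin n) (hij : i ≠ j) (hkl : k ≠ l) (hpq : p ≠ q) :
    ∑ ε : Fin n → Bool, (pmVec ε i * pmVec ε j) * (pmVec ε k * pmVec ε l)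
        * (pmVec ε p * pmVec ε q) =
      2 ^ n * (dl i k * (dl j p * dl l q + dl j q * dl l p)
        + dl i l * (dl j p * dl k q + dl j q * dl k p)
        + dl i p * (dl j k * dl q l + dl j l * dl q k)
        + dl i q * (dl j k * dl p l + dl j l * dl p k)) := by
  by_cases h1 : i = k
  · subst h1
    have h : ∑ ε : Fin n → Bool, (pmVec ε i * pmVec ε j) * (pmVec ε i * pmVec ε l)
        * (pmVec ε p * pmVec ε q) = ∑ ε, pmVec ε j * pmVec ε l * pmVec ε p * pmVec ε q := by
      refine Finset.sum_congr rfl fun ε _ => ?_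
      linear_combination (pmVec ε j * pmVec ε l * pmVec ε p * pmVec ε q) * pmVec_sq ε i
    rw [h, sum_four j l p q hpq]
    simp only [dl]
    grind
  by_cases h2 : i = l
  · subst h2
    have h : ∑ ε : Fin n → Bool, (pmVec ε i * pmVec ε j) * (pmVec ε k * pmVec ε i)
        * (pmVec ε p * pmVec ε q) = ∑ ε, pmVec ε j * pmVec ε k * pmVec ε p * pmVec ε q := by
      refine Finset.sum_congr rfl fun ε _ => ?_
      linear_combination (pmVec ε j * pmVec ε k * pmVec ε p * pmVec ε q) * pmVec_sq ε i
    rw [h, sum_four j k p q hpq]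
    simp only [dl]
    grind
  by_cases h3 : i = p
  · subst h3
    have h : ∑ ε : Fin n → Bool, (pmVec ε i * pmVec ε j) * (pmVec ε k * pmVec ε l)
        * (pmVec ε i * pmVec ε q) = ∑ ε, pmVec ε j * pmVec ε q * pmVec ε k * pmVec ε l := by
      refine Finset.sum_congr rfl fun ε _ => ?_
      linear_combination (pmVec ε j * pmVec ε l * pmVec ε k * pmVec ε q) * pmVec_sq ε i
    rw [h, sum_four j q k l hkl]
    simp only [dl]
    grind
  by_cases h4 : i = q
  · subst h4
    have h : ∑ ε : Fin n → Bool, (pmVec ε i * pmVec ε j) * (pmVec ε k * pmVec ε l)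
        * (pmVec ε p * pmVec ε i) = ∑ ε, pmVec ε j * pmVec ε p * pmVec ε k * pmVec ε l := by
      refine Finset.sum_congr rfl fun ε _ => ?_
      linear_combination (pmVec ε j * pmVec ε l * pmVec ε k * pmVec ε p) * pmVec_sq ε i
    rw [h, sum_four j p k l hkl]
    simp only [dl]
    grind
  rw [dl_ne h1, dl_ne h2, dl_ne h3, dl_ne h4]
  simp only [zero_mul, add_zero, mul_zero]
  apply sum_flip_zero i
  intro ε
  rw [pmVec_flip_same, pmVec_flip_ne i j hij, pmVec_flip_ne i k h1, pmVec_flip_ne i l h2,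
    pmVec_flip_ne i p h3, pmVec_flip_ne i q h4]
  ring

lemma half_sum {n : ℕ} (i : Fin n) (f : (Fin n → Bool) → ℂ)
    (h : ∀ ε, f (fun j => !ε j) = f ε) :
    ∑ ε, f ε = 2 * ∑ ε ∈ Finset.univ.filter (fun ε : Fin n → Bool => ε i = true), f ε := by
  rw [← Finset.sum_filter_add_sum_filter_not Finset.univ (fun ε : Fin n → Bool => ε i = true) f,
    two_mul]
  congr 1
  refine Finset.sum_bij' (fun ε _ => fun j => !ε j) (fun ε _ => fun j => !ε j) ?_ ?_ ?_ ?_ ?_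
  · intro ε; simp
  · intro ε; simp
  · intro ε; simp
  · intro ε; simp
  · intro ε _; exact (h ε).symm

lemma pmVec_not {n : ℕ} (ε : Fin n → Bool) (i : Fin n) :
    pmVec (fun j => !ε j) i = - pmVec ε i := by
  simp only [pmVec]
  by_cases h : ε i = true <;> simp [h]

lemma trace_form {n : ℕ} (A : Matrix (Fin n) (Fin n) ℂ) (hs : Aᵀ = A) (h0 : ∀ i, A i i = 0)
    (ε : Fin n → Bool) :
    ((Matrix.vecMulVec (pmVec ε) (pmVec ε) - 1) * A).trace
      = ∑ i, ∑ j, A i j * (pmVec ε i * pmVec ε j) := by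
  have hA : ∀ i j, A j i = A i j := fun i j => congrFun (congrFun hs i) j
  rw [sub_mul, one_mul, Matrix.trace_sub]
  have : A.trace = 0 := by simp [Matrix.trace, h0]
  rw [this, sub_zero]
  simp only [Matrix.trace, Matrix.diag, Matrix.mul_apply, Matrix.vecMulVec_apply]
  refine Finset.sum_congr rfl fun i _ => Finset.sum_congr rfl fun j _ => ?_
  rw [hA i j]; ring

lemma cube_expand {n : ℕ} (f : Fin n → Fin n → ℂ) :
    (∑ i, ∑ j, f i j) ^ 3 = ∑ i, ∑ j, ∑ k, ∑ l, ∑ p, ∑ q, f i j * f k l * f p q := by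
  simp only [← Finset.mul_sum, ← Finset.sum_mul]
  ring

lemma full_sum {n : ℕ} (A : Matrix (Fin n) (Fin n) ℂ) (hs : Aᵀ = A) (h0 : ∀ i, A i i = 0) :
    ∑ ε : Fin n → Bool, (∑ i, ∑ j, A i j * (pmVec ε i * pmVec ε j)) ^ 3
      = 2 ^ n * (8 * (A ^ 3).trace) := by
  have hA : ∀ i j, A j i = A i j := fun i j => congrFun (congrFun hs i) j
  have htr : (A ^ 3).trace = ∑ i, ∑ j, ∑ m, A i j * A i m * A j m := by
    rw [pow_succ, pow_two, Matrix.mul_assoc]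
    simp only [Matrix.trace, Matrix.diag, Matrix.mul_apply, Finset.mul_sum]
    refine Finset.sum_congr rfl fun i _ => Finset.sum_congr rfl fun j _ =>
      Finset.sum_congr rfl fun m _ => ?_
    rw [hA i m]; ring
  have step : ∑ ε : Fin n → Bool, (∑ i, ∑ j, A i j * (pmVec ε i * pmVec ε j)) ^ 3
      = ∑ i, ∑ j, ∑ k, ∑ l, ∑ p, ∑ q, A i j * A k l * A p q *
        (2 ^ n * (dl i k * (dl j p * dl l q + dl j q * dl l p)
        + dl i l * (dl j p * dl k q + dl j q * dl k p)
        + dl i p * (dl j k * dl q l + dl j l * dl q k)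
        + dl i q * (dl j k * dl p l + dl j l * dl p k))) := by
    simp only [cube_expand]
    rw [Finset.sum_comm]; refine Finset.sum_congr rfl fun i _ => ?_
    rw [Finset.sum_comm]; refine Finset.sum_congr rfl fun j _ => ?_
    rw [Finset.sum_comm]; refine Finset.sum_congr rfl fun k _ => ?_
    rw [Finset.sum_comm]; refine Finset.sum_congr rfl fun l _ => ?_
    rw [Finset.sum_comm]; refine Finset.sum_congr rfl fun p _ => ?_
    rw [Finset.sum_comm]; refine Finset.sum_congr rfl fun q _ => ?_
    by_cases hij : i = j
    · subst hij; simp [h0]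
    by_cases hkl : k = l
    · subst hkl; simp [h0]
    by_cases hpq : p = q
    · subst hpq; simp [h0]
    rw [← sum_six i j k l p q hij hkl hpq, Finset.mul_sum]
    refine Finset.sum_congr rfl fun ε _ => ?_
    ring
  rw [step, htr]
  simp only [Finset.mul_sum]
  refine Finset.sum_congr rfl fun i _ => Finset.sum_congr rfl fun j _ => ?_
  simp only [dl, mul_add, Finset.sum_add_distrib, mul_ite, ite_mul, mul_one, mul_zero, one_mul,
    zero_mul, Finset.sum_ite_eq, Finset.sum_ite_eq', Finset.mem_univ, if_true,
    Finset.sum_ite_irrel, Finset.sum_const_zero]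
  simp only [← Finset.sum_add_distrib]
  refine Finset.sum_congr rfl fun m _ => ?_
  rw [hA i m, hA j m]
  ring

lemma main_id (n : ℕ) (i0 : Fin n) (A : Matrix (Fin n) (Fin n) ℂ) (hs : Aᵀ = A)
    (h0 : ∀ i, A i i = 0) :
      (2 : ℂ) ^ (n + 2) * (A ^ 3).trace =
        ∑ ε ∈ Finset.univ.filter (fun ε : Fin n → Bool => ε i0 = true),
          ((Matrix.vecMulVec (pmVec ε) (pmVec ε) - 1) * A).trace ^ 3 := by
  simp only [trace_form A hs h0]
  have h := half_sum i0 (fun ε => (∑ i, ∑ j, A i j * (pmVec ε i * pmVec ε j)) ^ 3)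
    (by intro ε; simp only [pmVec_not, neg_mul_neg])
  rw [full_sum A hs h0] at h
  rw [pow_add]
  linear_combination (1/2 : ℂ) * h

lemma card_half (n : ℕ) (hn : 3 ≤ n) (i0 : Fin n) :
    (Finset.univ.filter (fun ε : Fin n → Bool => ε i0 = true)).card = 2 ^ (n - 1) := by
  have h := half_sum i0 (fun _ => (1 : ℂ)) (fun _ => rfl)
  simp only [Finset.sum_const, nsmul_eq_mul, mul_one] at h
  have h2 : (Finset.univ : Finset (Fin n → Bool)).card
      = 2 * (Finset.univ.filter (fun ε : Fin n → Bool => ε i0 = true)).card := by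
    exact_mod_cast h
  rw [Finset.card_univ, Fintype.card_fun, Fintype.card_bool, Fintype.card_fin] at h2
  obtain ⟨m, rfl⟩ : ∃ m, n = m + 1 := ⟨n - 1, by omega⟩
  rw [pow_succ] at h2
  simp only [Nat.add_sub_cancel]
  omega

theorem waring_decomposition_sMZ (n : ℕ) (hn : 3 ≤ n) :
    (∀ A : Matrix (Fin n) (Fin n) ℂ, Aᵀ = A → (∀ i, A i i = 0) →
      (2 : ℂ) ^ (n + 2) * (A ^ 3).trace =
        ∑ ε ∈ Finset.univ.filter (fun ε : Fin n → Bool => ε ⟨0, by omega⟩ = true),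
          ((Matrix.vecMulVec (pmVec ε) (pmVec ε) - 1) * A).trace ^ 3) ∧
    symRank (sMZ n) ≤ 2 ^ (n - 1) := by
  refine ⟨fun A hs h0 => main_id n _ A hs h0, ?_⟩
  apply Nat.sInf_le
  have i0 : Fin n := ⟨0, by omega⟩
  obtain ⟨c, hc⟩ := IsAlgClosed.exists_pow_nat_eq (((2 : ℂ) ^ (n + 2))⁻¹) (n := 3) (by norm_num)
  let e := (Finset.equivFinOfCardEq (card_half n hn i0)).symm
  let L : (Fin n → Bool) → (zeroDiagSym n →ₗ[ℂ] ℂ) := fun ε =>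
    c • ((Matrix.traceLinearMap (Fin n) ℂ ℂ).comp
      ((LinearMap.mulLeft ℂ (Matrix.vecMulVec (pmVec ε) (pmVec ε) - 1)).comp
        (zeroDiagSym n).subtype))
  refine ⟨fun i => L (e i).1, fun a => ?_⟩
  have hL : ∀ ε, L ε a =
      c * ((Matrix.vecMulVec (pmVec ε) (pmVec ε) - 1) * (a : Matrix (Fin n) (Fin n) ℂ)).trace :=
    fun ε => rfl
  have h1 : ∑ i, (L (e i).1 a) ^ 3 = ∑ x : {x // x ∈ Finset.univ.filter
      (fun ε : Fin n → Bool => ε i0 = true)}, (L x.1 a) ^ 3 :=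
    Equiv.sum_comp e (fun x => (L x.1 a) ^ 3)
  rw [h1, Finset.sum_coe_sort _ (fun ε => (L ε a) ^ 3)]
  simp only [hL, mul_pow, hc, ← Finset.mul_sum]
  rw [← main_id n i0 a.1 a.2.1 a.2.2, ← mul_assoc, inv_mul_cancel₀ (pow_ne_zero _ two_ne_zero), one_mul]
  rfl
end

section
/- For n ∈ {3, 4, 5}, the symmetric rank and symmetric border rank of sM^Z_n both equal 2^{n-1}: the cubic polynomial sM^Z_n on the space Z_n of symmetric n×n complex matrices with zero diagonal can be written as a sum of 2^{n-1} cubes of linear forms, and it does not lie in the closure of the set of cubics of symmetric rank at most 2^{n-1} − 1. -/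
open Filter Matrix

/-- Matrix of the map `Λ²ℂ⁵ → Λ³ℂ⁵`, wedging with `v`. -/
def kosz {R : Type*} [CommRing R] (v : Fin 5 → R) : Matrix (Fin 10) (Fin 10) R :=
  !![v 2, v 3, v 4, 0, 0, 0, 0, 0, 0, 0;
     -v 1, 0, 0, v 3, v 4, 0, 0, 0, 0, 0;
     0, -v 1, 0, -v 2, 0, v 4, 0, 0, 0, 0;
     0, 0, -v 1, 0, -v 2, -v 3, 0, 0, 0, 0;
     v 0, 0, 0, 0, 0, 0, v 3, v 4, 0, 0;
     0, v 0, 0, 0, 0, 0, -v 2, 0, v 4, 0;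
     0, 0, v 0, 0, 0, 0, 0, -v 2, -v 3, 0;
     0, 0, 0, v 0, 0, 0, v 1, 0, 0, v 4;
     0, 0, 0, 0, v 0, 0, 0, v 1, 0, -v 3;
     0, 0, 0, 0, 0, v 0, 0, 0, v 1, v 2]

/-- Matrix of the map `ℂ⁵ → Λ²ℂ⁵`, wedging with `v` (transposed). -/
def koszOne {R : Type*} [CommRing R] (v : Fin 5 → R) : Matrix (Fin 5) (Fin 10) R :=
  !![-v 1, -v 2, -v 3, -v 4, 0, 0, 0, 0, 0, 0;
     v 0, 0, 0, 0, -v 2, -v 3, -v 4, 0, 0, 0;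
     0, v 0, 0, 0, v 1, 0, 0, -v 3, -v 4, 0;
     0, 0, v 0, 0, 0, v 1, 0, v 2, 0, -v 4;
     0, 0, 0, v 0, 0, 0, v 1, 0, v 2, v 3]

theorem kosz_add {R : Type*} [CommRing R] (v w : Fin 5 → R) : kosz (v + w) = kosz v + kosz w := by
  ext I J
  fin_cases I <;> fin_cases J <;> simp [kosz] <;> ring

theorem kosz_smul {R : Type*} [CommRing R] (c : R) (v : Fin 5 → R) :
    kosz (c • v) = c • kosz v := by
  ext I J
  fin_cases I <;> fin_cases J <;> simp [kosz]

theorem kosz_zero {R : Type*} [CommRing R] : kosz (0 : Fin 5 → R) = 0 := by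
  have := kosz_smul (0 : R) 0
  simpa using this

theorem kosz_cast (v : Fin 5 → ℤ) (I J : Fin 10) :
    kosz (fun k => (v k : ℂ)) I J = ((kosz v I J : ℤ) : ℂ) := by
  fin_cases I <;> fin_cases J <;> simp [kosz]

theorem koszOne_mul_kosz {R : Type*} [CommRing R] (v : Fin 5 → R) : koszOne v * kosz v = 0 := by
  ext I J
  fin_cases I <;> fin_cases J <;>
    simp [kosz, koszOne, Matrix.mul_apply, Fin.sum_univ_succ] <;> ring

theorem koszOne_rank (v : Fin 5 → ℂ) (hv : v ≠ 0) : 4 ≤ (koszOne v).rank := by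
  obtain ⟨k, hk⟩ : ∃ k, v k ≠ 0 := by
    by_contra! h
    exact hv (funext h)
  have main : ∀ (r : Fin 4 → Fin 5) (c : Fin 4 → Fin 10),
      (∀ i j, i ≠ j → koszOne v (r i) (c j) = 0) → (∀ i, koszOne v (r i) (c i) ≠ 0) →
      4 ≤ (koszOne v).rank := by
    intro r c h0 h
    have hd : (koszOne v).submatrix r c = Matrix.diagonal fun i => koszOne v (r i) (c i) := by
      ext i j
      by_cases hij : i = j
      · subst hij
        simp
      · simp [Matrix.diagonal_apply_ne _ hij, h0 i j hij]
    have hdet : ((koszOne v).submatrix r c).det ≠ 0 := by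
      rw [hd, Matrix.det_diagonal]
      exact Finset.prod_ne_zero_iff.2 fun i _ => h i
    have h1 := Matrix.rank_of_det_ne_zero hdet
    have h2 := Matrix.rank_submatrix_le (koszOne v) r c
    rw [h1] at h2
    simpa using h2
  fin_cases k
  · simp at hk
    apply main ![1, 2, 3, 4] ![0, 1, 2, 3]
    · intro i j hij
      fin_cases i <;> fin_cases j <;> simp [koszOne] at hij ⊢
    · intro i
      fin_cases i <;> simpa [koszOne] using hk
  · simp at hk
    apply main ![0, 2, 3, 4] ![0, 4, 5, 6]
    · intro i j hij
      fin_cases i <;> fin_cases j <;> simp [koszOne] at hij ⊢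
    · intro i
      fin_cases i <;> simpa [koszOne] using hk
  · simp at hk
    apply main ![0, 1, 3, 4] ![1, 4, 7, 8]
    · intro i j hij
      fin_cases i <;> fin_cases j <;> simp [koszOne] at hij ⊢
    · intro i
      fin_cases i <;> simpa [koszOne] using hk
  · simp at hk
    apply main ![0, 1, 2, 4] ![2, 5, 7, 9]
    · intro i j hij
      fin_cases i <;> fin_cases j <;> simp [koszOne] at hij ⊢
    · intro i
      fin_cases i <;> simpa [koszOne] using hk
  · simp at hk
    apply main ![0, 1, 2, 3] ![3, 6, 8, 9]
    · intro i j hij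
      fin_cases i <;> fin_cases j <;> simp [koszOne] at hij ⊢
    · intro i
      fin_cases i <;> simpa [koszOne] using hk

theorem kosz_rank (v : Fin 5 → ℂ) : (kosz v).rank ≤ 6 := by
  by_cases hv : v = 0
  · subst hv
    simp [kosz_zero]
  · have h1 := koszOne_rank v hv
    have h2 := Matrix.rank_add_rank_le_card_of_mul_eq_zero (koszOne_mul_kosz v)
    simp at h2
    omega

theorem matrix_rank_add_le {m n : Type*} [Fintype m] [Fintype n] (A B : Matrix m n ℂ) :
    (A + B).rank ≤ A.rank + B.rank := by
  unfold Matrix.rank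
  rw [Matrix.mulVecLin_add]
  refine le_trans (Submodule.finrank_mono ?_)
    (Submodule.finrank_add_le_finrank_add_finrank _ _)
  exact LinearMap.range_add_le _ _

theorem matrix_rank_sum_le {m n ι : Type*} [Fintype m] [Fintype n] (s : Finset ι)
    (A : ι → Matrix m n ℂ) (d : ℕ) (h : ∀ i, (A i).rank ≤ d) :
    (∑ i ∈ s, A i).rank ≤ s.card * d := by
  classical
  induction s using Finset.induction_on with
  | empty => simp
  | insert a s ha ih =>
    rw [Finset.sum_insert ha, Finset.card_insert_of_notMem ha]
    have := matrix_rank_add_le (A a) (∑ i ∈ s, A i)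
    have := h a
    nlinarith

/-- Full polarization of a cubic. -/
def pol {W : Type*} [AddCommGroup W] (f : W → ℂ) (a b c : W) : ℂ :=
  f (a + b + c) - f (a + b) - f (a + c) - f (b + c) + f a + f b + f c

/-- The (restricted) Koszul flattening of a cubic. -/
def bigM {W : Type*} [AddCommGroup W] {N : ℕ} (f : W → ℂ) (e : Fin 5 → W) (X : Fin N → W) :
    Matrix (Fin 10 × Fin N) (Fin 10 × Fin N) ℂ :=
  Matrix.of fun p q => kosz (fun k => pol f (e k) (X p.2) (X q.2)) p.1 q.1

theorem bigM_cubes_rank {W : Type*} [AddCommGroup W] [Module ℂ W] {N r : ℕ}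
    (l : Fin r → (W →ₗ[ℂ] ℂ)) (e : Fin 5 → W) (X : Fin N → W) :
    (bigM (fun a => ∑ i, (l i a) ^ 3) e X).rank ≤ r * 6 := by
  have key : bigM (fun a => ∑ i, (l i a) ^ 3) e X = ∑ i,
      (Matrix.of fun (p : Fin 10 × Fin N) (I : Fin 10) => if p.1 = I then 6 * l i (X p.2) else 0) *
      kosz (fun k => l i (e k)) *
      (Matrix.of fun (J : Fin 10) (q : Fin 10 × Fin N) => if J = q.1 then l i (X q.2) else 0) := by
    ext p q
    rw [Matrix.sum_apply]
    have h1 : (fun k => pol (fun a => ∑ i, (l i a) ^ 3) (e k) (X p.2) (X q.2))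
        = ∑ i, (6 * l i (X p.2) * l i (X q.2)) • (fun k => l i (e k)) := by
      funext k
      simp only [pol, Finset.sum_apply, Pi.smul_apply, smul_eq_mul, map_add,
        ← Finset.sum_sub_distrib, ← Finset.sum_add_distrib]
      refine Finset.sum_congr rfl fun i _ => ?_
      ring
    have h2 : ∀ (s : Finset (Fin r)) (g : Fin r → Fin 5 → ℂ),
        kosz (∑ i ∈ s, g i) = ∑ i ∈ s, kosz (g i) := by
      intro s g
      classical
      induction s using Finset.induction_on with
      | empty => simp [kosz_zero]
      | insert a s ha ih => rw [Finset.sum_insert ha, Finset.sum_insert ha, kosz_add, ih]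
    simp only [bigM, Matrix.of_apply]
    rw [h1, h2, Matrix.sum_apply]
    refine Finset.sum_congr rfl fun i _ => ?_
    rw [kosz_smul]
    simp only [Matrix.mul_apply, Matrix.of_apply, Matrix.smul_apply, smul_eq_mul]
    simp
    ring
  rw [key]
  have := matrix_rank_sum_le Finset.univ (fun i =>
      (Matrix.of fun (p : Fin 10 × Fin N) (I : Fin 10) => if p.1 = I then 6 * l i (X p.2) else 0) *
      kosz (fun k => l i (e k)) *
      (Matrix.of fun (J : Fin 10) (q : Fin 10 × Fin N) => if J = q.1 then l i (X q.2) else 0)) 6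
    (fun i => (Matrix.rank_mul_le_left _ _).trans
      ((Matrix.rank_mul_le_right _ _).trans (kosz_rank _)))
  simpa using this

theorem flattening_bound {W : Type*} [AddCommGroup W] [Module ℂ W] {N r s : ℕ} (P : W → ℂ)
    (l : ℕ → Fin r → (W →ₗ[ℂ] ℂ))
    (hl : ∀ a, Tendsto (fun m => ∑ i, (l m i a) ^ 3) atTop (nhds (P a)))
    (e : Fin 5 → W) (X : Fin N → W) (ρ γ : Fin s → Fin 10 × Fin N)
    (hdet : ((bigM P e X).submatrix ρ γ).det ≠ 0) : s ≤ r * 6 := by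
  by_contra hs
  apply hdet
  have hpol : ∀ a b c, Tendsto (fun m => pol (fun a => ∑ i, (l m i a) ^ 3) a b c) atTop
      (nhds (pol P a b c)) := by
    intro a b c
    unfold pol
    exact ((((((hl _).sub (hl _)).sub (hl _)).sub (hl _)).add (hl _)).add (hl _)).add (hl _)
  have hk : ∀ I J, Continuous (fun v : Fin 5 → ℂ => kosz v I J) := by
    intro I J
    fin_cases I <;> fin_cases J <;> simp [kosz] <;> fun_prop
  have hM : Tendsto (fun m => (bigM (fun a => ∑ i, (l m i a) ^ 3) e X).submatrix ρ γ) atTop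
      (nhds ((bigM P e X).submatrix ρ γ)) := by
    refine tendsto_pi_nhds.2 fun i => tendsto_pi_nhds.2 fun j => ?_
    exact ((hk _ _).tendsto _).comp (tendsto_pi_nhds.2 fun k => hpol _ _ _)
  have hd := ((continuous_id.matrix_det).tendsto ((bigM P e X).submatrix ρ γ)).comp hM
  refine tendsto_nhds_unique hd ?_
  refine tendsto_const_nhds.congr fun m => ?_
  by_contra hne
  have h1 := Matrix.rank_of_det_ne_zero (A := (bigM (fun a => ∑ i, (l m i a) ^ 3) e X).submatrix ρ γ)
    (fun h => hne h.symm)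
  have h2 := Matrix.rank_submatrix_le (bigM (fun a => ∑ i, (l m i a) ^ 3) e X) ρ γ
  have h3 := bigM_cubes_rank (l m) e X
  rw [h1] at h2
  simp at h2
  omega

theorem pol_sMZ (n : ℕ) (a b c : zeroDiagSym n) :
    pol (sMZ n) a b c = 6 * ((a : Matrix (Fin n) (Fin n) ℂ) * (b : Matrix (Fin n) (Fin n) ℂ) *
      (c : Matrix (Fin n) (Fin n) ℂ)).trace := by
  obtain ⟨A, hA⟩ := a
  obtain ⟨B, hB⟩ := b
  obtain ⟨C, hC⟩ := c
  have hA : Aᵀ = A := hA.1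
  have hB : Bᵀ = B := hB.1
  have hC : Cᵀ = C := hC.1
  have h1 : (B * C * A).trace = (A * B * C).trace := Matrix.trace_mul_cycle B C A
  have h2 : (C * A * B).trace = (A * B * C).trace := (Matrix.trace_mul_cycle A B C).symm
  have h3 : (C * B * A).trace = (A * B * C).trace := by
    rw [← Matrix.trace_transpose (A * B * C), Matrix.transpose_mul, Matrix.transpose_mul,
      hA, hB, hC, Matrix.mul_assoc]
  have h4 : (A * C * B).trace = (A * B * C).trace := by
    rw [← h3, Matrix.trace_mul_cycle, Matrix.trace_mul_cycle]
  have h5 : (B * A * C).trace = (A * B * C).trace := by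
    rw [← h3, Matrix.trace_mul_cycle]
  simp only [pol, sMZ, Submodule.coe_add, pow_succ, pow_zero, one_mul, Matrix.mul_add,
    Matrix.add_mul, Matrix.trace_add]
  linear_combination h1 + h2 + h3 + h4 + h5

/-- An integral symmetric matrix with zero diagonal, as an element of `Z_n`. -/
def castZ {n : ℕ} (A : Fin n → Fin n → ℤ) (h : ∀ i j, A i j = A j i) (h0 : ∀ i, A i i = 0) :
    zeroDiagSym n :=
  ⟨Matrix.of fun i j => (A i j : ℂ), by
    refine ⟨?_, fun i => ?_⟩
    · ext i j
      simp [h i j]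
    · simp [h0]⟩

/-- The matrix of the edge `{i, j}` as an element of `Z_n`. -/
def edgeM {n : ℕ} (p : Fin n × Fin n) (h : p.1 ≠ p.2) : zeroDiagSym n :=
  ⟨Matrix.single p.1 p.2 1 + Matrix.single p.2 p.1 1, by
    refine ⟨?_, fun i => ?_⟩
    · simp [add_comm]
    · simp only [Matrix.add_apply, Matrix.single_apply]
      have h1 : ¬ (p.1 = i ∧ p.2 = i) := fun hh => h (hh.1.trans hh.2.symm)
      have h2 : ¬ (p.2 = i ∧ p.1 = i) := fun hh => h (hh.2.trans hh.1.symm)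
      simp [h1, h2]⟩

/-- The trace of `A * E_p * E_q` for edges `p`, `q`. -/
def tz {n : ℕ} (A : Fin n → Fin n → ℤ) (p q : Fin n × Fin n) : ℤ :=
  (if p.2 = q.1 then A q.2 p.1 else 0) + (if p.2 = q.2 then A q.1 p.1 else 0) +
  (if p.1 = q.1 then A q.2 p.2 else 0) + (if p.1 = q.2 then A q.1 p.2 else 0)

theorem trace_tz {n : ℕ} (A : Fin n → Fin n → ℤ) (h : ∀ i j, A i j = A j i)
    (h0 : ∀ i, A i i = 0) (p q : Fin n × Fin n) (hp : p.1 ≠ p.2) (hq : q.1 ≠ q.2) :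
    ((castZ A h h0 : Matrix (Fin n) (Fin n) ℂ) * (edgeM p hp : Matrix (Fin n) (Fin n) ℂ) *
      (edgeM q hq : Matrix (Fin n) (Fin n) ℂ)).trace = (tz A p q : ℂ) := by
  have key : ∀ (B : Matrix (Fin n) (Fin n) ℂ) (i j k l : Fin n),
      (B * (Matrix.single i j 1 * Matrix.single k l 1)).trace = if j = k then B l i else 0 := by
    intro B i j k l
    by_cases hjk : j = k
    · subst hjk
      simp [Matrix.trace_mul_single]
    · simp [hjk]
  simp only [castZ, edgeM, Matrix.mul_assoc, Matrix.mul_add, Matrix.add_mul, Matrix.trace_add, key,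
    tz, Matrix.of_apply]
  push_cast
  ring

/-- Integral Koszul flattening. -/
def zM {n N : ℕ} (Az : Fin 5 → Fin n → Fin n → ℤ) (ed : Fin N → Fin n × Fin n)
    (p q : Fin 10 × Fin N) : ℤ :=
  kosz (fun k => tz (Az k) (ed p.2) (ed q.2)) p.1 q.1

/-- Checks that the rows and columns listed give a triangular submatrix of the flattening. -/
def certOk {n N : ℕ} (Az : Fin 5 → Fin n → Fin n → ℤ) (ed : Fin N → Fin n × Fin n) :
    List ((Fin 10 × Fin N) × (Fin 10 × Fin N)) → Bool
  | [] => true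
  | p :: t => (zM Az ed p.1 p.2 != 0) && (t.all fun q => zM Az ed p.1 q.2 == 0) && certOk Az ed t

theorem certOk_spec {n N : ℕ} (Az : Fin 5 → Fin n → Fin n → ℤ) (ed : Fin N → Fin n × Fin n)
    (cert : List ((Fin 10 × Fin N) × (Fin 10 × Fin N))) (h : certOk Az ed cert = true) :
    (cert.Pairwise fun p q => zM Az ed p.1 q.2 = 0) ∧ ∀ p ∈ cert, zM Az ed p.1 p.2 ≠ 0 := by
  induction cert with
  | nil => simp
  | cons p t ih =>
    simp only [certOk, Bool.and_eq_true, List.all_eq_true, beq_iff_eq, bne_iff_ne] at h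
    obtain ⟨⟨h1, h2⟩, h3⟩ := h
    obtain ⟨i1, i2⟩ := ih h3
    refine ⟨List.pairwise_cons.2 ⟨h2, i1⟩, ?_⟩
    intro q hq
    rcases List.mem_cons.1 hq with rfl | hq
    · exact h1
    · exact i2 q hq

theorem border_lower_s18 {n N r : ℕ} (Az : Fin 5 → Fin n → Fin n → ℤ)
    (hA : ∀ k i j, Az k i j = Az k j i) (hA0 : ∀ k i, Az k i i = 0)
    (ed : Fin N → Fin n × Fin n) (hed : ∀ x, (ed x).1 ≠ (ed x).2)
    (cert : List ((Fin 10 × Fin N) × (Fin 10 × Fin N)))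
    (hcert : certOk Az ed cert = true)
    (l : ℕ → Fin r → (zeroDiagSym n →ₗ[ℂ] ℂ))
    (hl : ∀ a, Tendsto (fun m => ∑ i, (l m i a) ^ 3) atTop (nhds (sMZ n a))) :
    cert.length ≤ r * 6 := by
  obtain ⟨hp, hd⟩ := certOk_spec Az ed cert hcert
  have hent : ∀ p q, bigM (sMZ n) (fun k => castZ (Az k) (hA k) (hA0 k))
      (fun x => edgeM (ed x) (hed x)) p q = 6 * (zM Az ed p q : ℂ) := by
    intro p q
    simp only [bigM, Matrix.of_apply, pol_sMZ, trace_tz, zM]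
    rw [← kosz_cast]
    have := kosz_smul (6 : ℂ) (fun k => (tz (Az k) (ed p.2) (ed q.2) : ℂ))
    exact congrFun (congrFun this p.1) q.1
  refine flattening_bound (sMZ n) l hl (fun k => castZ (Az k) (hA k) (hA0 k))
      (fun x => edgeM (ed x) (hed x)) (fun i => (cert.get i).1) (fun i => (cert.get i).2) ?_
  rw [Matrix.det_of_isLowerTriangular]
  · refine Finset.prod_ne_zero_iff.2 fun i _ => ?_
    rw [Matrix.submatrix_apply, hent]
    have := hd (cert.get i) (List.get_mem _ _)
    simpa using this
  · intro i j hij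
    have hij : i < j := hij
    rw [Matrix.submatrix_apply, hent, List.pairwise_iff_get.1 hp i j hij]
    simp

/-- The quadratic form `A ↦ ∑ ε_i ε_j A_ij`, a linear form in `A`. -/
noncomputable def qf (n : ℕ) (ε : Fin n → ℂ) : zeroDiagSym n →ₗ[ℂ] ℂ where
  toFun A := ∑ i, ∑ j, ε i * ε j * (A : Matrix (Fin n) (Fin n) ℂ) i j
  map_add' A B := by
    simp [mul_add, Finset.sum_add_distrib]
  map_smul' c A := by
    simp only [Submodule.coe_smul, Matrix.smul_apply, smul_eq_mul, RingHom.id_apply,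
      Finset.mul_sum]
    refine Finset.sum_congr rfl fun i _ => Finset.sum_congr rfl fun j _ => ?_
    ring

theorem finish (n : ℕ) (hup : ∀ a, (2 : ℂ) ^ (n + 2) * sMZ n a =
      ∑ m : Fin (2 ^ (n - 1)), (qf n (fun i => if m.val.testBit i.val then -1 else 1) a) ^ 3)
    (hlow : ∀ (r : ℕ) (l : ℕ → Fin r → (zeroDiagSym n →ₗ[ℂ] ℂ)),
      (∀ a, Tendsto (fun m => ∑ i, (l m i a) ^ 3) atTop (nhds (sMZ n a))) → 2 ^ (n - 1) ≤ r) :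
    symRank (sMZ n) = 2 ^ (n - 1) ∧ symBorderRank (sMZ n) = 2 ^ (n - 1) := by
  have hmem : ∃ ℓ : Fin (2 ^ (n - 1)) → (zeroDiagSym n →ₗ[ℂ] ℂ),
      ∀ a, sMZ n a = ∑ i, (ℓ i a) ^ 3 := by
    obtain ⟨c, hc⟩ := IsAlgClosed.exists_pow_nat_eq (((2 : ℂ) ^ (n + 2))⁻¹) (n := 3) (by norm_num)
    refine ⟨fun m => c • qf n (fun i => if m.val.testBit i.val then -1 else 1), fun a => ?_⟩
    simp only [LinearMap.smul_apply, smul_eq_mul, mul_pow, ← Finset.mul_sum]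
    rw [← hup, hc, inv_mul_cancel_left₀]
    exact pow_ne_zero _ two_ne_zero
  constructor
  · apply le_antisymm
    · exact Nat.sInf_le hmem
    · refine le_csInf ⟨_, hmem⟩ ?_
      rintro r ⟨ℓ, hℓ⟩
      refine hlow r (fun _ => ℓ) fun a => ?_
      rw [hℓ a]
      exact tendsto_const_nhds
  · have hmem2 : 2 ^ (n - 1) ∈ {r : ℕ | ∃ ℓ : ℕ → Fin r → (zeroDiagSym n →ₗ[ℂ] ℂ),
        ∀ a, Tendsto (fun m => ∑ i, (ℓ m i a) ^ 3) atTop (nhds (sMZ n a))} := by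
      obtain ⟨ℓ, hℓ⟩ := hmem
      refine ⟨fun _ => ℓ, fun a => ?_⟩
      rw [hℓ a]
      exact tendsto_const_nhds
    apply le_antisymm
    · exact Nat.sInf_le hmem2
    · refine le_csInf ⟨_, hmem2⟩ ?_
      rintro r ⟨ℓ, hℓ⟩
      exact hlow r ℓ hℓ
def edges3 : Fin 3 → Fin 3 × Fin 3 :=
  ![(0, 1), (0, 2), (1, 2)]

def mats3 : Fin 5 → Fin 3 → Fin 3 → ℤ :=
  ![![![0, 1, 1], ![1, 0, 1], ![1, 1, 0]],
    ![![0, 0, 0], ![0, 0, 1], ![0, 1, 0]],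
    ![![0, 1, 0], ![1, 0, 0], ![0, 0, 0]],
    ![![0, 0, 0], ![0, 0, 0], ![0, 0, 0]],
    ![![0, 0, 1], ![0, 0, 1], ![1, 1, 0]]]

def cert3 : List ((Fin 10 × Fin 3) × (Fin 10 × Fin 3)) :=
  [((3, 2), (4, 1)), ((3, 0), (2, 1)), ((0, 0), (2, 2)), ((1, 2), (4, 0)), ((1, 1), (0, 0)),
   ((4, 2), (7, 0)), ((1, 0), (4, 2)), ((3, 1), (2, 0)), ((6, 2), (7, 1)), ((4, 1), (0, 2)),
   ((6, 1), (7, 2)), ((2, 0), (5, 2)), ((9, 2), (5, 0)), ((9, 1), (9, 2)), ((2, 2), (3, 1)),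
   ((7, 0), (3, 2)), ((2, 1), (1, 0)), ((9, 0), (8, 1)), ((7, 2), (3, 0))]

theorem certOk3 : certOk mats3 edges3 cert3 = true := by decide +kernel

theorem lower3 (r : ℕ) (l : ℕ → Fin r → (zeroDiagSym 3 →ₗ[ℂ] ℂ))
    (hl : ∀ a, Tendsto (fun m => ∑ i, (l m i a) ^ 3) atTop (nhds (sMZ 3 a))) : 2 ^ (3 - 1) ≤ r := by
  have h := border_lower_s18 mats3 (by decide +kernel) (by decide +kernel) edges3 (by decide +kernel)
    cert3 certOk3 l hl
  have hlen : cert3.length = 19 := by decide +kernel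
  norm_num
  omega

theorem upper3 (a : zeroDiagSym 3) : (2 : ℂ) ^ (3 + 2) * sMZ 3 a =
    ∑ m : Fin (2 ^ (3 - 1)), (qf 3 (fun i => if m.val.testBit i.val then -1 else 1) a) ^ 3 := by
  obtain ⟨A, hA, hA0⟩ := a
  have hs : ∀ i j, A i j = A j i := fun i j => congrFun (congrFun hA j) i
  have d0 := hA0 0
  have d1 := hA0 1
  have s10 := hs 1 0
  have d2 := hA0 2
  have s20 := hs 2 0
  have s21 := hs 2 1
  simp only [qf, sMZ, LinearMap.coe_mk, AddHom.coe_mk, pow_succ (_ : Matrix _ _ ℂ), pow_zero,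
    one_mul, Matrix.trace, Matrix.diag_apply, Matrix.mul_apply]
  change _ = ∑ m : Fin 4, _
  simp [Fin.sum_univ_succ, Nat.testBit, d0, d1, d2, s10, s20, s21]
  ring

def edges4 : Fin 6 → Fin 4 × Fin 4 :=
  ![(0, 1), (0, 2), (0, 3), (1, 2), (1, 3), (2, 3)]

def mats4 : Fin 5 → Fin 4 → Fin 4 → ℤ :=
  ![![![0, 1, 0, 0], ![1, 0, 0, 0], ![0, 0, 0, 0], ![0, 0, 0, 0]],
    ![![0, 0, 0, 0], ![0, 0, 0, 1], ![0, 0, 0, 1], ![0, 1, 1, 0]],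
    ![![0, 0, 0, 0], ![0, 0, 0, 0], ![0, 0, 0, 0], ![0, 0, 0, 0]],
    ![![0, 0, 0, 1], ![0, 0, 0, 0], ![0, 0, 0, 0], ![1, 0, 0, 0]],
    ![![0, 0, 0, 0], ![0, 0, 0, 0], ![0, 0, 0, 0], ![0, 0, 0, 0]]]

def cert4 : List ((Fin 10 × Fin 6) × (Fin 10 × Fin 6)) :=
  [((4, 0), (6, 4)), ((2, 1), (1, 2)), ((5, 3), (1, 1)), ((0, 0), (1, 4)), ((4, 2), (0, 4)),
   ((6, 5), (8, 1)), ((6, 3), (2, 1)), ((4, 5), (6, 1)), ((2, 4), (1, 3)), ((9, 0), (8, 2)),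
   ((2, 2), (1, 0)), ((6, 2), (2, 4)), ((9, 1), (5, 3)), ((6, 0), (8, 4)), ((1, 3), (0, 5)),
   ((2, 3), (1, 5)), ((9, 5), (8, 3)), ((6, 1), (8, 5)), ((9, 3), (5, 1)), ((4, 1), (0, 3)),
   ((1, 5), (3, 1)), ((6, 4), (2, 2)), ((9, 2), (5, 4)), ((7, 2), (3, 4)), ((4, 4), (0, 2)),
   ((9, 4), (5, 2)), ((1, 1), (3, 5)), ((3, 1), (5, 5)), ((4, 3), (0, 1)), ((1, 2), (0, 0)),
   ((3, 3), (2, 5)), ((1, 4), (3, 0)), ((7, 0), (6, 2)), ((8, 0), (9, 4)), ((7, 1), (3, 3)),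
   ((3, 2), (2, 0)), ((8, 4), (7, 3)), ((7, 5), (6, 3)), ((3, 4), (5, 0)), ((7, 4), (3, 2)),
   ((8, 2), (4, 4)), ((8, 5), (9, 1)), ((8, 1), (9, 5))]

theorem certOk4 : certOk mats4 edges4 cert4 = true := by decide +kernel

theorem lower4 (r : ℕ) (l : ℕ → Fin r → (zeroDiagSym 4 →ₗ[ℂ] ℂ))
    (hl : ∀ a, Tendsto (fun m => ∑ i, (l m i a) ^ 3) atTop (nhds (sMZ 4 a))) : 2 ^ (4 - 1) ≤ r := by
  have h := border_lower_s18 mats4 (by decide +kernel) (by decide +kernel) edges4 (by decide +kernel)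
    cert4 certOk4 l hl
  have hlen : cert4.length = 43 := by decide +kernel
  norm_num
  omega

theorem upper4 (a : zeroDiagSym 4) : (2 : ℂ) ^ (4 + 2) * sMZ 4 a =
    ∑ m : Fin (2 ^ (4 - 1)), (qf 4 (fun i => if m.val.testBit i.val then -1 else 1) a) ^ 3 := by
  obtain ⟨A, hA, hA0⟩ := a
  have hs : ∀ i j, A i j = A j i := fun i j => congrFun (congrFun hA j) i
  have d0 := hA0 0
  have d1 := hA0 1
  have s10 := hs 1 0
  have d2 := hA0 2
  have s20 := hs 2 0
  have s21 := hs 2 1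
  have d3 := hA0 3
  have s30 := hs 3 0
  have s31 := hs 3 1
  have s32 := hs 3 2
  simp only [qf, sMZ, LinearMap.coe_mk, AddHom.coe_mk, pow_succ (_ : Matrix _ _ ℂ), pow_zero,
    one_mul, Matrix.trace, Matrix.diag_apply, Matrix.mul_apply]
  change _ = ∑ m : Fin 8, _
  simp [Fin.sum_univ_succ, Nat.testBit, d0, d1, d2, d3, s10, s20, s21, s30, s31, s32]
  ring

def edges5 : Fin 10 → Fin 5 × Fin 5 :=
  ![(0, 1), (0, 2), (0, 3), (0, 4), (1, 2), (1, 3), (1, 4), (2, 3), (2, 4), (3, 4)]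

def mats5 : Fin 5 → Fin 5 → Fin 5 → ℤ :=
  ![![![0, 0, 1, 0, 1], ![0, 0, 0, 0, 0], ![1, 0, 0, 0, 0], ![0, 0, 0, 0, 0], ![1, 0, 0, 0, 0]],
    ![![0, 0, 0, 0, 0], ![0, 0, 0, 0, 1], ![0, 0, 0, 0, 0], ![0, 0, 0, 0, 0], ![0, 1, 0, 0, 0]],
    ![![0, 1, 0, 0, 0], ![1, 0, 0, 0, 0], ![0, 0, 0, 0, 0], ![0, 0, 0, 0, 0], ![0, 0, 0, 0, 0]],
    ![![0, 0, 0, 0, 1], ![0, 0, 0, 1, 0], ![0, 0, 0, 1, 0], ![0, 1, 1, 0, 0], ![1, 0, 0, 0, 0]],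
    ![![0, 0, 0, 0, 0], ![0, 0, 0, 0, 0], ![0, 0, 0, 0, 0], ![0, 0, 0, 0, 1], ![0, 0, 0, 1, 0]]]

def cert5 : List ((Fin 10 × Fin 10) × (Fin 10 × Fin 10)) :=
  [((2, 7), (5, 8)), ((9, 1), (9, 4)), ((9, 7), (5, 2)), ((7, 1), (3, 8)), ((8, 5), (7, 9)),
   ((9, 9), (8, 5)), ((2, 1), (3, 4)), ((2, 0), (1, 3)), ((3, 7), (5, 4)), ((5, 9), (1, 2)),
   ((2, 9), (1, 5)), ((3, 1), (4, 4)), ((8, 7), (4, 2)), ((1, 1), (3, 2)), ((0, 0), (1, 6)),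
   ((3, 5), (2, 9)), ((1, 3), (0, 0)), ((7, 7), (9, 8)), ((0, 9), (1, 8)), ((5, 0), (1, 4)),
   ((2, 8), (5, 7)), ((2, 4), (3, 1)), ((5, 7), (8, 8)), ((5, 1), (6, 4)), ((0, 1), (0, 4)),
   ((4, 5), (7, 6)), ((6, 3), (2, 8)), ((1, 7), (4, 8)), ((8, 1), (9, 2)), ((7, 3), (6, 0)),
   ((9, 5), (8, 9)), ((5, 5), (8, 6)), ((9, 6), (9, 3)), ((7, 5), (6, 9)), ((4, 6), (7, 5)),
   ((9, 3), (8, 0)), ((8, 0), (7, 3)), ((3, 3), (2, 0)), ((3, 9), (2, 5)), ((2, 5), (1, 9)),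
   ((2, 3), (1, 0)), ((1, 0), (0, 3)), ((6, 9), (8, 2)), ((0, 3), (0, 6)), ((4, 0), (6, 6)),
   ((5, 6), (6, 3)), ((6, 7), (8, 4)), ((6, 5), (7, 2)), ((4, 3), (0, 8)), ((4, 1), (6, 8)),
   ((4, 9), (0, 2)), ((7, 4), (3, 0)), ((7, 6), (9, 5)), ((0, 5), (2, 6)), ((6, 0), (2, 4)),
   ((9, 2), (5, 9)), ((3, 8), (5, 1)), ((3, 2), (4, 5)), ((3, 6), (4, 3)), ((1, 6), (3, 9)),
   ((9, 8), (5, 3)), ((2, 2), (3, 5)), ((1, 4), (3, 7)), ((1, 9), (0, 5)), ((3, 0), (2, 3)),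
   ((0, 2), (1, 1)), ((3, 4), (4, 1)), ((0, 8), (2, 7)), ((2, 6), (3, 3)), ((6, 1), (7, 4)),
   ((9, 4), (9, 1)), ((4, 7), (7, 8)), ((8, 8), (9, 9)), ((7, 8), (9, 7)), ((9, 0), (8, 3)),
   ((7, 9), (6, 5)), ((5, 2), (1, 7)), ((0, 4), (0, 1)), ((6, 2), (8, 1)), ((8, 4), (4, 0)),
   ((4, 4), (6, 7)), ((1, 8), (4, 7)), ((5, 8), (8, 7)), ((5, 4), (6, 1)), ((6, 8), (2, 1)),
   ((6, 4), (7, 1)), ((8, 6), (9, 0)), ((1, 5), (0, 9)), ((8, 2), (4, 9)), ((4, 8), (7, 7)),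
   ((8, 3), (7, 0))]

theorem certOk5 : certOk mats5 edges5 cert5 = true := by decide +kernel

theorem lower5 (r : ℕ) (l : ℕ → Fin r → (zeroDiagSym 5 →ₗ[ℂ] ℂ))
    (hl : ∀ a, Tendsto (fun m => ∑ i, (l m i a) ^ 3) atTop (nhds (sMZ 5 a))) : 2 ^ (5 - 1) ≤ r := by
  have h := border_lower_s18 mats5 (by decide +kernel) (by decide +kernel) edges5 (by decide +kernel)
    cert5 certOk5 l hl
  have hlen : cert5.length = 91 := by decide +kernel
  norm_num
  omega

theorem upper5 (a : zeroDiagSym 5) : (2 : ℂ) ^ (5 + 2) * sMZ 5 a =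
    ∑ m : Fin (2 ^ (5 - 1)), (qf 5 (fun i => if m.val.testBit i.val then -1 else 1) a) ^ 3 := by
  obtain ⟨A, hA, hA0⟩ := a
  have hs : ∀ i j, A i j = A j i := fun i j => congrFun (congrFun hA j) i
  have d0 := hA0 0
  have d1 := hA0 1
  have s10 := hs 1 0
  have d2 := hA0 2
  have s20 := hs 2 0
  have s21 := hs 2 1
  have d3 := hA0 3
  have s30 := hs 3 0
  have s31 := hs 3 1
  have s32 := hs 3 2
  have d4 := hA0 4
  have s40 := hs 4 0
  have s41 := hs 4 1
  have s42 := hs 4 2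
  have s43 := hs 4 3
  simp only [qf, sMZ, LinearMap.coe_mk, AddHom.coe_mk, pow_succ (_ : Matrix _ _ ℂ), pow_zero,
    one_mul, Matrix.trace, Matrix.diag_apply, Matrix.mul_apply]
  change _ = ∑ m : Fin 16, _
  simp [Fin.sum_univ_succ, Nat.testBit, d0, d1, d2, d3, d4, s10, s20, s21, s30, s31, s32, s40, s41, s42, s43]
  ring

theorem symRank_and_symBorderRank_sMZ_small (n : ℕ) (hn : n = 3 ∨ n = 4 ∨ n = 5) :
    symRank (sMZ n) = 2 ^ (n - 1) ∧ symBorderRank (sMZ n) = 2 ^ (n - 1) := by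
  rcases hn with rfl | rfl | rfl
  · exact finish 3 upper3 lower3
  · exact finish 4 upper4 lower4
  · exact finish 5 upper5 lower5
end
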